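/- arXiv:2005.12614 — 2 statements merged into one kernel-verified Lean document; each statement's English description precedes it below -/
import Mathlib

section
/- Let a > 0 and let Γ̃ = {x ∈ ℝ³ : x₂² + x₃² = a²} be an infinite cylinder with inward normal n(y) = -(0, y₂/a, y₃/a). For any constant q̃ ∈ ℝ³, the double layer potential D[Γ̃, q̃](x) equals -8π q̃ if x₂² + x₃² < a² and 0 if x₂² + x₃² > a². -/
open MeasureTheory Real Finset

/-- The stresslet kernel `T_{ijk}(r) = -6 r_i r_j r_k / |r|⁵` in ℝ³. -/
noncomputable def stresslet (r : Fin 3 → ℝ) (i j k : Fin 3) : ℝ :=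
  -6 * r i * r j * r k / (Real.sqrt (r 0 ^ 2 + r 1 ^ 2 + r 2 ^ 2)) ^ 5

open Filter Topology Set in
lemma aux_p_lim (s : ℝ) (hs : 0 < s) :
    Tendsto (fun t : ℝ => t * (√(t^2+s))⁻¹) atTop (𝓝 1) ∧
    Tendsto (fun t : ℝ => t * (√(t^2+s))⁻¹) atBot (𝓝 (-1)) ∧
    Tendsto (fun t : ℝ => (√(t^2+s))⁻¹) atTop (𝓝 0) ∧
    Tendsto (fun t : ℝ => (√(t^2+s))⁻¹) atBot (𝓝 0) := by
  have h3 : Tendsto (fun t : ℝ => (√(t^2+s))⁻¹) atTop (𝓝 0) := by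
    apply Tendsto.inv_tendsto_atTop
    apply tendsto_sqrt_atTop.comp
    exact tendsto_atTop_add_const_right _ _ (tendsto_pow_atTop (by norm_num))
  have h1 : Tendsto (fun t : ℝ => t * (√(t^2+s))⁻¹) atTop (𝓝 1) := by
    have : Tendsto (fun t : ℝ => √(1 - s * ((√(t^2+s))⁻¹)^2)) atTop (𝓝 (√(1 - s * 0^2))) :=
      ((tendsto_const_nhds.sub (tendsto_const_nhds.mul (h3.pow 2)))).sqrt
    simp only [ne_eq, OfNat.ofNat_ne_zero, not_false_eq_true, zero_pow, mul_zero, sub_zero,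
      sqrt_one] at this
    refine this.congr' ?_
    filter_upwards [eventually_ge_atTop 0] with t ht
    have hp : 0 < t^2+s := by positivity
    have hq : 0 < √(t^2+s) := by positivity
    have hsq : √(t^2+s)^2 = t^2+s := Real.sq_sqrt hp.le
    have e : 1 - s * ((√(t^2+s))⁻¹)^2 = (t * (√(t^2+s))⁻¹)^2 := by
      field_simp
      rw [hsq]; ring
    rw [e, Real.sqrt_sq (by positivity)]
  have hneg : Tendsto (fun t : ℝ => -t) atBot atTop := tendsto_neg_atBot_atTop
  refine ⟨h1, ?_, h3, ?_⟩
  · have := (h1.comp hneg).neg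
    refine this.congr fun t => ?_
    simp
  · refine (h3.comp hneg).congr fun t => ?_
    simp

lemma aux_deriv (s α β γ t : ℝ) (hs : 0 < s) :
    HasDerivAt (fun t : ℝ => α * (t * (√(t^2+s))⁻¹)^3 / (3 * s) - β * ((√(t^2+s))⁻¹)^3 / 3
      + γ * ((t * (√(t^2+s))⁻¹) - (t * (√(t^2+s))⁻¹)^3 / 3) / s^2)
      ((α * t^2 + β * t + γ) / √(t^2+s)^5) t := by
  have hp : 0 < t^2+s := by positivity
  have hq : 0 < √(t^2+s) := by positivity
  have hsq : √(t^2+s)^2 = t^2+s := Real.sq_sqrt hp.le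
  have hm : HasDerivAt (fun t : ℝ => (√(t^2+s))⁻¹) (-t * ((√(t^2+s))⁻¹)^3) t := by
    have h := ((((hasDerivAt_id t).pow 2).add_const s).sqrt hp.ne').inv hq.ne'
    refine h.congr_deriv ?_
    simp only [Pi.pow_apply, id]
    field_simp
    norm_num
  have hpd : HasDerivAt (fun t : ℝ => t * (√(t^2+s))⁻¹) (s * ((√(t^2+s))⁻¹)^3) t := by
    refine ((hasDerivAt_id t).mul hm).congr_deriv ?_
    simp only [id]
    field_simp
    rw [hsq]; ring
  have := (((hpd.pow 3).const_mul α).div_const (3*s)).sub (((hm.pow 3).const_mul β).div_const 3) 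
    |>.add (((hpd.sub ((hpd.pow 3).div_const 3)).const_mul γ).div_const (s^2))
  refine this.congr_deriv ?_
  have e : s = √(t^2+s)^2 - t^2 := by rw [hsq]; ring
  push_cast
  have hs0 := hs.ne'
  clear this hm hpd
  generalize √(t^2+s) = r at *
  field_simp
  subst e
  ring

open Filter Topology Set in
lemma aux_int (s α β γ : ℝ) (hs : 0 < s)
    (hint : Integrable fun t : ℝ => (α * t^2 + β * t + γ) / √(t^2+s)^5) :
    ∫ t : ℝ, (α * t^2 + β * t + γ) / √(t^2+s)^5 = 2 * α / (3 * s) + 4 * γ / (3 * s^2) := by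
  obtain ⟨h1, h2, h3, h4⟩ := aux_p_lim s hs
  rw [integral_of_hasDerivAt_of_tendsto (fun t => aux_deriv s α β γ t hs) hint
    (((((h2.pow 3).const_mul α).div_const (3*s)).sub (((h4.pow 3).const_mul β).div_const 3)).add
    (((h2.sub ((h2.pow 3).div_const 3)).const_mul γ).div_const (s^2)))
    (((((h1.pow 3).const_mul α).div_const (3*s)).sub (((h3.pow 3).const_mul β).div_const 3)).add
    (((h1.sub ((h1.pow 3).div_const 3)).const_mul γ).div_const (s^2)))]
  field_simp
  ring

lemma aux_bound (s d K α β γ t : ℝ) (hd : 0 < d) (hd1 : d ≤ 1) (hs : d ≤ s)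
    (h1 : |α| ≤ K) (h2 : |β| ≤ K) (h3 : |γ| ≤ K) :
    ‖(α * t^2 + β * t + γ) / √(t^2+s)^5‖ ≤ (2 * K / (d^2 * √d)) * (1+t^2)⁻¹ := by
  have hK : 0 ≤ K := (abs_nonneg _).trans h1
  have hp : 0 < t^2+s := by nlinarith [sq_nonneg t]
  have hsq : √(t^2+s)^2 = t^2+s := Real.sq_sqrt hp.le
  have hnum : |α * t^2 + β * t + γ| ≤ 2 * K * (1 + t^2) := by
    have ht : |t| ≤ (1 + t^2)/2 := by rw [abs_le]; constructor <;> nlinarith [sq_nonneg (t-1), sq_nonneg (t+1)]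
    have e1 : |α * t^2| ≤ K * t^2 := by rw [abs_mul, abs_of_nonneg (sq_nonneg t)]; gcongr
    have e2 : |β * t| ≤ K * ((1+t^2)/2) := by rw [abs_mul]; gcongr
    have := abs_add_three (α * t^2) (β * t) γ
    nlinarith [mul_nonneg hK (sq_nonneg t)]
  have hden : d^2 * √d * (1+t^2)^2 ≤ √(t^2+s)^5 := by
    have : √(t^2+s)^5 = (t^2+s)^2 * √(t^2+s) := by rw [← hsq]; simp; ring
    rw [this]
    have h1 : √d ≤ √(t^2+s) := Real.sqrt_le_sqrt (by nlinarith [sq_nonneg t])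
    have h2 : d * (1+t^2) ≤ t^2+s := by nlinarith [sq_nonneg t]
    have h3 : (d * (1+t^2))^2 ≤ (t^2+s)^2 := by gcongr
    calc _ = (d * (1+t^2))^2 * √d := by ring
      _ ≤ _ := by gcongr
  rw [norm_div, Real.norm_eq_abs, Real.norm_eq_abs, abs_of_nonneg (by positivity : 0 ≤ √(t^2+s)^5)]
  have hsd : 0 < √d := by positivity
  calc _ ≤ (2 * K * (1 + t^2)) / (d^2 * √d * (1+t^2)^2) := by gcongr
    _ = _ := by field_simp

open Set in
lemma aux_swap (α β γ s : ℝ → ℝ) (hα : Continuous α) (hβ : Continuous β) (hγ : Continuous γ)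
    (hs : Continuous s) (hpos : ∀ θ, 0 < s θ) (x0 : ℝ) :
    ∫ y : ℝ, ∫ θ in (0:ℝ)..(2*π), (α θ * (x0-y)^2 + β θ * (x0-y) + γ θ) / √((x0-y)^2 + s θ)^5
     = ∫ θ in (0:ℝ)..(2*π), (2 * α θ / (3 * s θ) + 4 * γ θ / (3 * s θ^2)) := by
  have h2π : (0:ℝ) ≤ 2*π := by positivity
  have hcpt : IsCompact (Icc (0:ℝ) (2*π)) := isCompact_Icc
  have hne : (Icc (0:ℝ) (2*π)).Nonempty := ⟨0, by simp [h2π]⟩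
  obtain ⟨θ0, _, hθ0⟩ := hcpt.exists_isMinOn hne hs.continuousOn
  obtain ⟨K1, hK1⟩ := hcpt.exists_bound_of_continuousOn hα.continuousOn
  obtain ⟨K2, hK2⟩ := hcpt.exists_bound_of_continuousOn hβ.continuousOn
  obtain ⟨K3, hK3⟩ := hcpt.exists_bound_of_continuousOn hγ.continuousOn
  set d := min (s θ0) 1 with hd
  have hdpos : 0 < d := lt_min (hpos _) one_pos
  set K := max K1 (max K2 K3)
  set C := (2 * K / (d^2 * √d))
  have hb : ∀ θ ∈ Icc (0:ℝ) (2*π), ∀ t, ‖(α θ * t^2 + β θ * t + γ θ) / √(t^2+s θ)^5‖ ≤ C * (1+t^2)⁻¹ := by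
    intro θ hθ t
    apply aux_bound _ d K _ _ _ _ hdpos (min_le_right _ _) ((min_le_left _ _).trans (hθ0 hθ))
    · exact (hK1 θ hθ).trans (le_max_left _ _)
    · exact (hK2 θ hθ).trans ((le_max_left _ _).trans (le_max_right _ _))
    · exact (hK3 θ hθ).trans ((le_max_right _ _).trans (le_max_right _ _))
  have hg : Integrable (fun t : ℝ => C * (1+t^2)⁻¹) := integrable_inv_one_add_sq.const_mul C
  have hne0 : ∀ θ t : ℝ, √(t^2+s θ)^5 ≠ 0 := by
    intro θ t
    have := hpos θ
    positivity
  have hcont : Continuous (fun p : ℝ × ℝ => (α p.2 * (x0-p.1)^2 + β p.2 * (x0-p.1) + γ p.2) / √((x0-p.1)^2 + s p.2)^5) := by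
    apply Continuous.div (by fun_prop) (by fun_prop)
    intro p; exact hne0 _ _
  simp_rw [intervalIntegral.integral_of_le h2π]
  rw [integral_integral_swap]
  · apply setIntegral_congr_fun measurableSet_Ioc
    intro θ hθ
    have hθ' := Ioc_subset_Icc_self hθ
    simp only
    rw [integral_sub_left_eq_self (fun t => (α θ * t^2 + β θ * t + γ θ) / √(t^2+s θ)^5) volume x0]
    apply aux_int _ _ _ _ (hpos θ)
    refine hg.mono' ?_ (.of_forall (hb θ hθ'))
    apply Continuous.aestronglyMeasurable
    apply Continuous.div (by fun_prop) (by fun_prop)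
    intro t; exact hne0 _ _
  · have hg' : Integrable (fun p : ℝ × ℝ => C * (1+(x0-p.1)^2)⁻¹ * 1) (volume.prod (volume.restrict (Ioc 0 (2*π)))) :=
      (hg.comp_sub_left x0).mul_prod (integrable_const (1:ℝ))
    refine hg'.mono' hcont.aestronglyMeasurable ?_
    have : (volume : Measure ℝ).prod (volume.restrict (Ioc 0 (2*π))) = (volume.prod volume).restrict (Set.univ ×ˢ Ioc 0 (2*π)) := by
      rw [← Measure.prod_restrict, Measure.restrict_univ]
    rw [this]
    refine (ae_restrict_iff' (MeasurableSet.univ.prod measurableSet_Ioc)).2 (.of_forall ?_)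
    rintro ⟨y, θ⟩ ⟨_, hθ⟩
    simpa using hb θ (Ioc_subset_Icc_self hθ) (x0 - y)

lemma aux_circ (a X Y : ℝ) (ha : 0 < a) :
    (X^2+Y^2 < a^2 → ∫ θ in (0:ℝ)..(2*π), -((X - a * cos θ) * (a * cos θ) + (Y - a * sin θ) * (a * sin θ)) /
      ((X - a * cos θ)^2 + (Y - a * sin θ)^2) = 2 * π) ∧
    (a^2 < X^2+Y^2 → ∫ θ in (0:ℝ)..(2*π), -((X - a * cos θ) * (a * cos θ) + (Y - a * sin θ) * (a * sin θ)) /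
      ((X - a * cos θ)^2 + (Y - a * sin θ)^2) = 0) := by
  set z : ℂ := ⟨X, Y⟩ with hz
  have hnz : ‖z‖^2 = X^2+Y^2 := by rw [← Complex.normSq_eq_norm_sq, Complex.normSq_mk]; ring
  have key : X^2+Y^2 ≠ a^2 → ∫ θ in (0:ℝ)..(2*π), -((X - a * cos θ) * (a * cos θ) + (Y - a * sin θ) * (a * sin θ)) /
      ((X - a * cos θ)^2 + (Y - a * sin θ)^2) = (∮ w in C(0, a), (w - z)⁻¹).im := by
    intro hne
    have hw : ∀ θ, circleMap 0 a θ - z ≠ 0 := by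
      intro θ h
      have : z = circleMap 0 a θ := (sub_eq_zero.1 h).symm
      apply hne
      rw [← hnz, this]
      simp
    rw [circleIntegral, ← Complex.imCLM_apply, ← ContinuousLinearMap.intervalIntegral_comp_comm]
    · congr 1
      ext θ
      have h := hw θ
      have hzz : circleMap 0 a θ = ⟨a * cos θ, a * sin θ⟩ := by
        rw [circleMap_zero]
        apply Complex.ext <;> simp [Complex.exp_ofReal_mul_I_re, Complex.exp_ofReal_mul_I_im]
      simp only [deriv_circleMap, Complex.imCLM_apply, smul_eq_mul]
      rw [hzz] at h ⊢
      have e : Complex.normSq ((⟨a * cos θ, a * sin θ⟩ : ℂ) - z) = (X - a * cos θ)^2 + (Y - a * sin θ)^2 := by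
        simp [Complex.normSq_apply, hz]; ring
      simp only [Complex.mul_im, Complex.mul_re, Complex.inv_re, Complex.inv_im, e, Complex.I_re, Complex.I_im, Complex.sub_re, Complex.sub_im]
      simp only [hz]
      ring
    · apply Continuous.intervalIntegrable
      simp only [deriv_circleMap, smul_eq_mul]
      apply Continuous.mul (by fun_prop)
      exact Continuous.inv₀ (by fun_prop) hw
  constructor
  · intro h
    rw [key h.ne, circleIntegral.integral_sub_inv_of_mem_ball]
    · simp
    · rw [mem_ball_zero_iff]
      exact lt_of_pow_lt_pow_left₀ 2 ha.le (by rw [hnz]; exact h)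
  · intro h
    have hza : a < ‖z‖ := lt_of_pow_lt_pow_left₀ 2 (norm_nonneg _) (by rw [hnz]; exact h)
    rw [key h.ne', Complex.circleIntegral_eq_zero_of_differentiable_on_off_countable ha.le Set.countable_empty]
    · simp
    · apply ContinuousOn.inv₀ (by fun_prop)
      intro w hw h0
      rw [mem_closedBall_zero_iff, sub_eq_zero.1 h0] at hw
      linarith
    · intro w hw
      have hw := hw.1
      apply DifferentiableAt.inv (by fun_prop)
      intro h0
      rw [mem_ball_zero_iff, sub_eq_zero.1 h0] at hw
      linarith

lemma aux_exact (a X Y : ℝ) (hs : ∀ θ, 0 < (X - a * cos θ)^2 + (Y - a * sin θ)^2) :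
    (∫ θ in (0:ℝ)..(2*π), (X - a * cos θ) * (Y - a * sin θ) * -((X - a * cos θ) * (a * cos θ) + (Y - a * sin θ) * (a * sin θ)) /
      ((X - a * cos θ)^2 + (Y - a * sin θ)^2)^2 = 0) ∧
    (∫ θ in (0:ℝ)..(2*π), ((X - a * cos θ)^2 - (Y - a * sin θ)^2) * -((X - a * cos θ) * (a * cos θ) + (Y - a * sin θ) * (a * sin θ)) /
      ((X - a * cos θ)^2 + (Y - a * sin θ)^2)^2 = 0) := by
  have hu : ∀ θ, HasDerivAt (fun θ => X - a * cos θ) (a * sin θ) θ := fun θ => by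
    simpa using ((hasDerivAt_cos θ).const_mul a).const_sub X
  have hv : ∀ θ, HasDerivAt (fun θ => Y - a * sin θ) (-(a * cos θ)) θ := fun θ => by
    simpa using ((hasDerivAt_sin θ).const_mul a).const_sub Y
  constructor
  · rw [intervalIntegral.integral_eq_sub_of_hasDerivAt (f := fun θ => -(1/2) * ((X - a * cos θ)^2 / ((X - a * cos θ)^2 + (Y - a * sin θ)^2)))]
    · simp
    · intro θ _
      have h := (((hu θ).pow 2).div (((hu θ).pow 2).add ((hv θ).pow 2)) (hs θ).ne').const_mul (-(1/2))
      refine h.congr_deriv ?_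
      have := (hs θ).ne'
      simp only [Pi.add_apply, Pi.pow_apply]
      field_simp
      ring
    · apply Continuous.intervalIntegrable
      apply Continuous.div (by fun_prop) (by fun_prop)
      intro θ; exact pow_ne_zero _ (hs θ).ne'
  · rw [intervalIntegral.integral_eq_sub_of_hasDerivAt (f := fun θ => ((X - a * cos θ) * (Y - a * sin θ) / ((X - a * cos θ)^2 + (Y - a * sin θ)^2)))]
    · simp
    · intro θ _
      have h := (((hu θ).mul (hv θ)).div (((hu θ).pow 2).add ((hv θ).pow 2)) (hs θ).ne')
      refine h.congr_deriv ?_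
      have := (hs θ).ne'
      simp only [Pi.add_apply, Pi.pow_apply, Pi.mul_apply]
      field_simp
      ring
    · apply Continuous.intervalIntegrable
      apply Continuous.div (by fun_prop) (by fun_prop)
      intro θ; exact pow_ne_zero _ (hs θ).ne'

lemma aux_main (a : ℝ) (q x : Fin 3 → ℝ) (i : Fin 3) (hne : x 1 ^ 2 + x 2 ^ 2 ≠ a ^ 2) :
    (∫ y1 : ℝ, ∫ θ in (0:ℝ)..(2 * π), (∑ j : Fin 3, ∑ k : Fin 3,
          stresslet (x - ![y1, a * Real.cos θ, a * Real.sin θ]) i j k * q j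
            * (-(![0, Real.cos θ, Real.sin θ] : Fin 3 → ℝ)) k) * a)
      = -4 * q i * ∫ θ in (0:ℝ)..(2*π), -((x 1 - a * cos θ) * (a * cos θ) + (x 2 - a * sin θ) * (a * sin θ)) /
      ((x 1 - a * cos θ)^2 + (x 2 - a * sin θ)^2) := by
  have hs : ∀ θ, 0 < (x 1 - a * cos θ)^2 + (x 2 - a * sin θ)^2 := by
    intro θ
    by_contra h
    have h1 : x 1 - a * cos θ = 0 := by nlinarith [sq_nonneg (x 1 - a * cos θ), sq_nonneg (x 2 - a * sin θ)]
    have h2 : x 2 - a * sin θ = 0 := by nlinarith [sq_nonneg (x 1 - a * cos θ), sq_nonneg (x 2 - a * sin θ)]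
    apply hne
    rw [sub_eq_zero.1 h1, sub_eq_zero.1 h2]
    linear_combination a^2 * sin_sq_add_cos_sq θ
  obtain ⟨hE1, hE2⟩ := aux_exact a (x 1) (x 2) hs
  set P : ℝ → ℝ := fun θ => -((x 1 - a * cos θ) * (a * cos θ) + (x 2 - a * sin θ) * (a * sin θ)) with hP
  set s : ℝ → ℝ := fun θ => (x 1 - a * cos θ)^2 + (x 2 - a * sin θ)^2 with hsd
  set R1 : ℝ → ℝ := fun θ => x 1 - a * cos θ with hR1
  set R2 : ℝ → ℝ := fun θ => x 2 - a * sin θ with hR2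
  have hPc : Continuous P := by fun_prop
  have hsc : Continuous s := by fun_prop
  have hR1c : Continuous R1 := by fun_prop
  have hR2c : Continuous R2 := by fun_prop
  have hI0 : IntervalIntegrable (fun θ => P θ / s θ) volume 0 (2*π) :=
    (hPc.div hsc fun θ => (hs θ).ne').intervalIntegrable _ _
  have hI1 : IntervalIntegrable (fun θ => R1 θ * R2 θ * P θ / s θ ^ 2) volume 0 (2*π) :=
    (((hR1c.mul hR2c).mul hPc).div (hsc.pow 2) fun θ => pow_ne_zero _ (hs θ).ne').intervalIntegrable _ _
  have hI2 : IntervalIntegrable (fun θ => (R1 θ ^ 2 - R2 θ ^ 2) * P θ / s θ ^ 2) volume 0 (2*π) :=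
    ((((hR1c.pow 2).sub (hR2c.pow 2)).mul hPc).div (hsc.pow 2) fun θ => pow_ne_zero _ (hs θ).ne').intervalIntegrable _ _
  change ∫ θ in (0:ℝ)..(2*π), R1 θ * R2 θ * P θ / s θ ^ 2 = 0 at hE1
  change ∫ θ in (0:ℝ)..(2*π), (R1 θ ^ 2 - R2 θ ^ 2) * P θ / s θ ^ 2 = 0 at hE2
  change _ = -4 * q i * ∫ θ in (0:ℝ)..(2*π), P θ / s θ
  have hcomb : ∀ c0 c1 c2 : ℝ, ∫ θ in (0:ℝ)..(2*π), (c0 * (P θ / s θ) +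
      c1 * (R1 θ * R2 θ * P θ / s θ ^ 2) + c2 * ((R1 θ ^ 2 - R2 θ ^ 2) * P θ / s θ ^ 2))
      = c0 * ∫ θ in (0:ℝ)..(2*π), P θ / s θ := by
    intro c0 c1 c2
    rw [intervalIntegral.integral_add ((hI0.const_mul _).add (hI1.const_mul _)) (hI2.const_mul _),
      intervalIntegral.integral_add (hI0.const_mul _) (hI1.const_mul _)]
    simp only [intervalIntegral.integral_const_mul, hE1, hE2]
    ring
  have hsr : ∀ θ, s θ = R1 θ ^ 2 + R2 θ ^ 2 := fun θ => rfl
  fin_cases i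
  · have := aux_swap (fun θ => -6 * q 0 * P θ) (fun θ => -6 * (R1 θ * q 1 + R2 θ * q 2) * P θ)
      (fun θ => 0) s (by fun_prop) (by fun_prop) (by fun_prop) hsc hs (x 0)
    trans
    · trans
      swap
      · exact this
      congr 1; ext y; congr 1; ext θ
      simp [stresslet, Fin.sum_univ_three, hP, hsd, hR1, hR2, add_assoc]
      ring
    · rw [← hcomb _ 0 0]
      congr 1; ext θ
      have := (hs θ).ne'
      simp only [Fin.zero_eta]
      field_simp
      ring
  · have := aux_swap (fun θ => 0) (fun θ => -6 * q 0 * R1 θ * P θ)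
      (fun θ => -6 * R1 θ * (R1 θ * q 1 + R2 θ * q 2) * P θ) s (by fun_prop) (by fun_prop) (by fun_prop) hsc hs (x 0)
    trans
    · trans
      swap
      · exact this
      congr 1; ext y; congr 1; ext θ
      simp [stresslet, Fin.sum_univ_three, hP, hsd, hR1, hR2, add_assoc]
      ring
    · rw [← hcomb _ (-8 * q 2) (-4 * q 1)]
      congr 1; ext θ
      have := (hs θ).ne'
      simp only [Fin.mk_one]
      field_simp
      rw [hsr]
      ring
  · have := aux_swap (fun θ => 0) (fun θ => -6 * q 0 * R2 θ * P θ)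
      (fun θ => -6 * R2 θ * (R1 θ * q 1 + R2 θ * q 2) * P θ) s (by fun_prop) (by fun_prop) (by fun_prop) hsc hs (x 0)
    trans
    · trans
      swap
      · exact this
      congr 1; ext y; congr 1; ext θ
      simp [stresslet, Fin.sum_univ_three, hP, hsd, hR1, hR2, add_assoc]
      ring
    · rw [← hcomb _ (-8 * q 1) (4 * q 2)]
      congr 1; ext θ
      have := (hs θ).ne'
      simp only [Fin.reduceFinMk]
      field_simp
      rw [hsr]
      ring

/-- Stresslet identity for an infinite cylindrical pipe
`Γ̃ = {x : x₂² + x₃² = a²}` with inward unit normal `n(y) = -(0, y₂/a, y₃/a)`: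
the double layer potential of a constant density `q̃` equals `-8π q̃` inside the
pipe and `0` outside. The pipe is parametrized by `(y₁, θ) ∈ ℝ × [0, 2π)`, with
`y = (y₁, a cos θ, a sin θ)` and surface element `a dy₁ dθ`. -/
theorem stmt_6 (a : ℝ) (ha : 0 < a) (q : Fin 3 → ℝ) (x : Fin 3 → ℝ) (i : Fin 3) :
    (x 1 ^ 2 + x 2 ^ 2 < a ^ 2 →
      (∫ y1 : ℝ, ∫ θ in (0:ℝ)..(2 * π), (∑ j : Fin 3, ∑ k : Fin 3,
          stresslet (x - ![y1, a * Real.cos θ, a * Real.sin θ]) i j k * q j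
            * (-(![0, Real.cos θ, Real.sin θ] : Fin 3 → ℝ)) k) * a)
      = -8 * π * q i) ∧
    (a ^ 2 < x 1 ^ 2 + x 2 ^ 2 →
      (∫ y1 : ℝ, ∫ θ in (0:ℝ)..(2 * π), (∑ j : Fin 3, ∑ k : Fin 3,
          stresslet (x - ![y1, a * Real.cos θ, a * Real.sin θ]) i j k * q j
            * (-(![0, Real.cos θ, Real.sin θ] : Fin 3 → ℝ)) k) * a)
      = 0) := by
  constructor
  · intro h
    rw [aux_main a q x i h.ne, (aux_circ a (x 1) (x 2) ha).1 h]
    ring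
  · intro h
    rw [aux_main a q x i h.ne', (aux_circ a (x 1) (x 2) ha).2 h]
    ring
end

section
/- The function ψ(t) defined by ψ(t) = (t²+1) exp(4t/(t²-1)) / [(t²-1)(1+exp(4t/(t²-1)))]² for t ∈ (-1,1) and ψ(t) = 0 otherwise is infinitely differentiable on ℝ. -/
/-- The bump function `ψ`, vanishing outside `(-1,1)`. -/
noncomputable def psiBump (t : ℝ) : ℝ :=
  if -1 < t ∧ t < 1 then
    (t ^ 2 + 1) * Real.exp (4 * t / (t ^ 2 - 1))
      / ((t ^ 2 - 1) * (1 + Real.exp (4 * t / (t ^ 2 - 1)))) ^ 2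
  else 0

/-- `ψ` as a globally smooth expression in `expNegInvGlue`. -/
theorem psiBump_eq (t : ℝ) : psiBump t =
    (t ^ 2 + 1) * (((Polynomial.X ^ 2 : Polynomial ℝ).eval ((1 - t) / 2)⁻¹ *
        expNegInvGlue ((1 - t) / 2)) *
      ((Polynomial.X ^ 2 : Polynomial ℝ).eval ((1 + t) / 2)⁻¹ * expNegInvGlue ((1 + t) / 2)))
      / (16 * (expNegInvGlue ((1 - t) / 2) + expNegInvGlue ((1 + t) / 2)) ^ 2) := by
  unfold psiBump
  split_ifs with h
  · obtain ⟨h1, h2⟩ := h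
    have hu : 0 < 1 - t := by linarith
    have hv : 0 < 1 + t := by linarith
    have hne : t ^ 2 - 1 ≠ 0 := by nlinarith
    have ha : expNegInvGlue ((1 - t) / 2) = Real.exp (-((1 - t) / 2)⁻¹) := by
      rw [expNegInvGlue, if_neg (by linarith)]
    have hb : expNegInvGlue ((1 + t) / 2) = Real.exp (-((1 + t) / 2)⁻¹) := by
      rw [expNegInvGlue, if_neg (by linarith)]
    have he : Real.exp (4 * t / (t ^ 2 - 1)) =
        Real.exp (-((1 - t) / 2)⁻¹) / Real.exp (-((1 + t) / 2)⁻¹) := by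
      rw [← Real.exp_sub]
      congr 1
      have : t ^ 2 - 1 = -((1 - t) * (1 + t)) := by ring
      rw [this]
      field_simp
      ring
    rw [ha, hb, he]
    have hA := Real.exp_pos (-((1 - t) / 2)⁻¹)
    have hB := Real.exp_pos (-((1 + t) / 2)⁻¹)
    generalize Real.exp (-((1 - t) / 2)⁻¹) = a at *
    generalize Real.exp (-((1 + t) / 2)⁻¹) = b at *
    have h3 : t ^ 2 - 1 = -((1 - t) * (1 + t)) := by ring
    have h4 : 1 + a / b = (a + b) / b := by field_simp; ring
    have h5 : 0 < a + b := by positivity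
    rw [h3, h4]
    simp only [Polynomial.eval_pow, Polynomial.eval_X]
    field_simp
    try norm_num
  · by_cases h1 : -1 < t
    · have h2 : 1 ≤ t := by
        by_contra h2
        exact h ⟨h1, not_le.mp h2⟩
      rw [expNegInvGlue.zero_of_nonpos (x := (1 - t) / 2) (by linarith)]
      simp
    · rw [expNegInvGlue.zero_of_nonpos (x := (1 + t) / 2) (by linarith)]
      simp

/-- `ψ` is infinitely differentiable on all of `ℝ`. -/
theorem stmt_7 : ContDiff ℝ (⊤ : ℕ∞) psiBump := by
  have hu : ContDiff ℝ (⊤ : ℕ∞) (fun t : ℝ => (1 - t) / 2) := by fun_prop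
  have hv : ContDiff ℝ (⊤ : ℕ∞) (fun t : ℝ => (1 + t) / 2) := by fun_prop
  have hG := expNegInvGlue.contDiff_polynomial_eval_inv_mul (n := ⊤) (Polynomial.X ^ 2)
  have hE := expNegInvGlue.contDiff (n := ⊤)
  rw [funext psiBump_eq]
  refine ContDiff.div (ContDiff.mul (by fun_prop) ((hG.comp hu).mul (hG.comp hv)))
    (contDiff_const.mul (((hE.comp hu).add (hE.comp hv)).pow 2)) fun t => ?_
  have h := Real.smoothTransition.pos_denom ((1 - t) / 2)
  rw [show 1 - (1 - t) / 2 = (1 + t) / 2 by ring] at h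
  have : 0 < 16 * (expNegInvGlue ((1 - t) / 2) + expNegInvGlue ((1 + t) / 2)) ^ 2 := by positivity
  exact this.ne'
end
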